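/- arXiv:2407.04012 — 2 statements merged into one kernel-verified Lean document; each statement's English description precedes it below -/
import Mathlib

section
/- Let R be a ring. A chain complex X in Ch(R) is a projective object of the category Ch(R) if and only if X is exact (its homology vanishes in every degree) and for every i ∈ ℤ the cokernel of d_{i+1} : X_{i+1} → X_i is a projective left R-module. -/
open CategoryTheory Limits

universe u

namespace HomologicalComplex

variable {C : Type*} [Category* C] [Abelian C] {ι : Type*} {c : ComplexShape ι}

/-- The chain map from the disk on `A` (in degrees `i` and `j`) to the sphere on `A`
(in degree `i`). -/
noncomputable def doubleIdToSingle [DecidableEq ι] (A : C) {i j : ι} (hij : c.Rel i j)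
    (h : i ≠ j) : double (𝟙 A) hij ⟶ (single C c i).obj A :=
  mkHomFromDouble hij h (singleObjXSelf c i A).inv 0 (by simp) (by simp)

@[simp]
lemma doubleIdToSingle_f [DecidableEq ι] (A : C) {i j : ι} (hij : c.Rel i j) (h : i ≠ j) :
    (doubleIdToSingle A hij h).f i =
      (doubleXIso₀ (𝟙 A) hij).hom ≫ (singleObjXSelf c i A).inv := by
  simp [doubleIdToSingle]

instance [DecidableEq ι] (A : C) {i j : ι} (hij : c.Rel i j) (h : i ≠ j) :
    Epi (doubleIdToSingle A hij h) := by
  refine epi_of_epi_f _ fun k ↦ ?_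
  by_cases hk : k = i
  · subst hk
    rw [doubleIdToSingle_f]
    infer_instance
  · exact ⟨fun _ _ _ ↦ (isZero_single_obj_X c i A k hk).eq_of_src _ _⟩

/-- A projective complex is exact in every degree with an outgoing differential. -/
lemma isZero_homology_of_projective (K : HomologicalComplex C c) [Projective K] {i j : ι}
    (hij : c.Rel i j) (h : i ≠ j) : IsZero (K.homology i) := by
  classical
  let p : K ⟶ (single C c i).obj (K.opcycles i) := mkHomToSingle (K.pOpcycles i) (by simp)
  let l := Projective.factorThru p (doubleIdToSingle (K.opcycles i) hij h)
  have hl : l.f i ≫ (doubleXIso₀ (𝟙 _) hij).hom = K.pOpcycles i := by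
    have := congr_hom (Projective.factorThru_comp p (doubleIdToSingle (K.opcycles i) hij h)) i
    rw [comp_f, doubleIdToSingle_f, mkHomToSingle_f, ← Category.assoc] at this
    exact (cancel_mono _).1 this
  have hs : K.fromOpcycles i j ≫ l.f j ≫ (doubleXIso₁ (𝟙 _) hij h).hom = 𝟙 _ := by
    rw [← cancel_epi (K.pOpcycles i), p_fromOpcycles_assoc, ← l.comm_assoc, double_d _ _ h]
    simp [hl]
  have : Mono (K.fromOpcycles i j) := (SplitMono.mk _ hs).mono
  rw [IsZero.iff_id_eq_zero, ← cancel_mono (K.homologyι i), ← cancel_mono (K.fromOpcycles i j)]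
  simp

/-- The cokernels of the differentials of a projective complex are projective. -/
lemma projective_cokernel_d_of_projective (K : HomologicalComplex C c) [Projective K] {i j : ι}
    (hij : c.Rel i j) : Projective (cokernel (K.d i j)) where
  factors {A B} f e _ := by
    classical
    have hd (k : ι) (hk : c.Rel k j) : K.d k j ≫ cokernel.π (K.d i j) ≫ f = 0 := by
      obtain rfl := c.prev_eq hk hij
      simp
    let p : K ⟶ (single C c j).obj B := mkHomToSingle (cokernel.π (K.d i j) ≫ f) hd
    let l := Projective.factorThru p ((single C c j).map e)
    refine ⟨cokernel.desc _ (l.f j ≫ (singleObjXSelf c j A).hom) ?_, ?_⟩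
    · rw [← l.comm_assoc]
      simp
    · have := congr_hom (Projective.factorThru_comp p ((single C c j).map e)) j
      rw [comp_f, mkHomToSingle_f, single_map_f_self] at this
      rw [← cancel_epi (cokernel.π _), ← cancel_mono (singleObjXSelf c j B).inv]
      simpa [l] using this

end HomologicalComplex

namespace ChainComplex

variable {C : Type*} [Category* C] [Abelian C] (X : ChainComplex C ℤ)

/-- The short complex `coker d_{k+2} ⟶ X_k ⟶ coker d_{k+1}`. -/
noncomputable abbrev cokernelShortComplex (k : ℤ) : ShortComplex C :=
  ShortComplex.mk (cokernel.desc (X.d (k + 1 + 1) (k + 1)) (X.d (k + 1) k) (by simp))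
    (cokernel.π (X.d (k + 1) k)) (by simp [← cancel_epi (cokernel.π _)])

variable {X} in
lemma cokernelShortComplex_shortExact {k : ℤ} (h : IsZero (X.homology (k + 1))) :
    (X.cokernelShortComplex k).ShortExact where
  exact := by
    let S := ShortComplex.mk (X.d (k + 1) k) (cokernel.π (X.d (k + 1) k)) (by simp)
    have hS : S.Exact := S.exact_of_g_is_cokernel (cokernelIsCokernel _)
    let φ : S ⟶ X.cokernelShortComplex k :=
      { τ₁ := cokernel.π _
        τ₂ := 𝟙 _
        τ₃ := 𝟙 _ }
    have : Epi φ.τ₁ := inferInstanceAs (Epi (cokernel.π _))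
    have : IsIso φ.τ₂ := inferInstanceAs (IsIso (𝟙 _))
    have : Mono φ.τ₃ := inferInstanceAs (Mono (𝟙 _))
    exact (ShortComplex.exact_iff_of_epi_of_isIso_of_mono φ).1 hS
  mono_f := by
    rw [← X.exactAt_iff_isZero_homology,
      X.exactAt_iff' (k + 1 + 1) (k + 1) k (by simp) (by simp)] at h
    exact h.mono_cokernelDesc
  epi_g := inferInstanceAs (Epi (cokernel.π _))

/-- An exact complex whose differentials have projective cokernels is projective. -/
lemma projective_of_isZero_homology (h : ∀ i, IsZero (X.homology i))
    [∀ i, Projective (cokernel (X.d (i + 1) i))] : Projective X where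
  factors {B A} f g _ := by
    let σ (k : ℤ) : (X.cokernelShortComplex k).Splitting :=
      (cokernelShortComplex_shortExact (h (k + 1))).splittingOfProjective
    let s (k : ℤ) : cokernel (X.d (k + 1) k) ⟶ X.X k := (σ k).s
    let r (k : ℤ) : X.X k ⟶ cokernel (X.d (k + 1 + 1) (k + 1)) := (σ k).r
    have hr (k : ℤ) : X.d (k + 1) k ≫ r k = cokernel.π _ := by
      have := cokernel.π (X.d (k + 1 + 1) (k + 1)) ≫= (σ k).f_r
      simpa using this
    have hs (k : ℤ) : s (k + 1) ≫ X.d (k + 1) k =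
        cokernel.desc (X.d (k + 1 + 1) (k + 1)) (X.d (k + 1) k) (by simp) := by
      have := (σ (k + 1)).s_g =≫
        cokernel.desc (X.d (k + 1 + 1) (k + 1)) (X.d (k + 1) k) (by simp)
      simpa using this
    have hid (k : ℤ) : r k ≫ s (k + 1) ≫ X.d (k + 1) k + cokernel.π _ ≫ s k = 𝟙 _ := by
      rw [hs]
      exact (σ k).id
    let a (k : ℤ) : cokernel (X.d (k + 1) k) ⟶ B.X k :=
      Projective.factorThru (s k ≫ f.f k) (g.f k)
    have ha (k : ℤ) : a k ≫ g.f k = s k ≫ f.f k := Projective.factorThru_comp _ _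
    refine ⟨{ f := fun k ↦ r k ≫ a (k + 1) ≫ B.d (k + 1) k + cokernel.π _ ≫ a k
              comm' := ?_ }, ?_⟩
    · rintro _ k rfl
      simp [reassoc_of% hr]
    · ext k
      have := hid k =≫ f.f k
      simpa [-HomologicalComplex.Hom.comm, -HomologicalComplex.Hom.comm_assoc, reassoc_of% ha, ha,
        ← g.comm, ← f.comm] using this

end ChainComplex

/-- Theorem 6.5(i) for chain complexes: a chain complex of left `R`-modules is a projective
object of `Ch(R)` if and only if it is exact and all the cokernels of its differentials are
projective `R`-modules. -/
theorem statement18 {R : Type u} [Ring R] (X : ChainComplex (ModuleCat.{u} R) ℤ) :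
    Projective X ↔
      ((∀ i : ℤ, IsZero (X.homology i)) ∧
        ∀ i : ℤ, Projective (cokernel (X.d (i + 1) i))) := by
  exact ⟨fun _ ↦ ⟨fun i ↦ X.isZero_homology_of_projective (j := i - 1) (by simp) (by lia),
    fun i ↦ X.projective_cokernel_d_of_projective rfl⟩,
    fun ⟨h, _⟩ ↦ ChainComplex.projective_of_isZero_homology X h⟩
end

section
/- Let R be a ring. A chain complex X in Ch(R) is an injective object of the category Ch(R) if and only if X is exact (its homology vanishes in every degree) and for every i ∈ ℤ the kernel of d_i : X_i → X_{i−1} is an injective left R-module. -/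
open CategoryTheory Limits

universe u

namespace HomologicalComplex

variable {C ι : Type*} [Category* C] [Abelian C] {c : ComplexShape ι}

/-- A morphism between complexes whose source vanishes outside of degree `j` is a monomorphism
as soon as its component in degree `j` is. -/
lemma mono_from_single [DecidableEq ι] {A : C} {K : HomologicalComplex C c} {j : ι}
    (φ : (single C c j).obj A ⟶ K) [Mono (φ.f j)] : Mono φ := by
  refine mono_of_mono_f φ fun i => ?_
  by_cases h : i = j
  · subst h
    infer_instance
  · exact ⟨fun _ _ _ => (isZero_single_obj_X c j A i h).eq_of_tgt _ _⟩

/-- The cycles of an injective complex are injective. -/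
lemma injective_cycles (K : HomologicalComplex C c) [Injective K] (i : ι) :
    Injective (K.cycles i) where
  factors {A B} g f _ := by
    classical
    have : Mono (((single C c i).map f).f i) := by
      rw [single_map_f_self]
      infer_instance
    have : Mono ((single C c i).map f) := mono_from_single _
    let φ : (single C c i).obj A ⟶ K := mkHomFromSingle (g ≫ K.iCycles i) (by simp)
    let ψ := Injective.factorThru φ ((single C c i).map f)
    have hψ : ((single C c i).map f).f i ≫ ψ.f i = φ.f i := by
      rw [← comp_f, Injective.comp_factorThru]
    refine ⟨K.liftCycles ((singleObjXSelf c i B).inv ≫ ψ.f i) _ rfl (by simp), ?_⟩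
    rw [← cancel_mono (K.iCycles i), Category.assoc, liftCycles_i,
      ← cancel_epi (singleObjXSelf c i A).hom]
    simpa [φ, single_map_f_self] using hψ

/-- An injective complex is exact in every degree which is the target of a differential. -/
lemma exactAt_of_injective (K : HomologicalComplex C c) [Injective K] {i j : ι}
    (hij : c.Rel i j) (h : i ≠ j) : K.ExactAt j := by
  classical
  rw [exactAt_iff_exact_up_to_refinements K i j _ (c.prev_eq' hij) rfl]
  intro A x hx
  let ι₀ : (single C c j).obj A ⟶ double (𝟙 A) hij :=
    mkHomFromSingle (doubleXIso₁ (𝟙 A) hij h).inv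
      (fun k _ => by rw [double_d_eq_zero₀ _ _ _ _ h.symm, comp_zero])
  have : Mono (ι₀.f j) := by
    rw [mkHomFromSingle_f]
    infer_instance
  have : Mono ι₀ := mono_from_single _
  let φ : (single C c j).obj A ⟶ K := mkHomFromSingle x
    (fun k hk => by rwa [c.next_eq' hk] at hx)
  let ψ := Injective.factorThru φ ι₀
  have hψ : ι₀.f j ≫ ψ.f j = φ.f j := by
    rw [← comp_f, Injective.comp_factorThru]
  refine ⟨A, 𝟙 A, inferInstance, (doubleXIso₀ (𝟙 A) hij).inv ≫ ψ.f i, ?_⟩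
  rw [← cancel_epi (singleObjXSelf c j A).hom]
  simp only [ι₀, φ, mkHomFromSingle_f, Category.assoc] at hψ
  simp [← hψ, double_d _ _ h]

/-- If `K` is exact in degree `j`, then `0 ⟶ K.cycles i ⟶ K.X i ⟶ K.cycles j ⟶ 0` is a short
exact sequence for the differential from degree `i` to degree `j`. -/
lemma shortExact_cycles (K : HomologicalComplex C c) {i j : ι} (hij : c.Rel i j)
    (hj : K.ExactAt j) :
    (ShortComplex.mk (K.iCycles i) (K.toCycles i j)
      (by simp [← cancel_mono (K.iCycles j)])).ShortExact where
  exact := by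
    rw [ShortComplex.exact_iff_exact_up_to_refinements]
    intro A x hx
    dsimp at x hx
    have hx' : x ≫ K.d i j = 0 := by rw [← K.toCycles_i i j, reassoc_of% hx, zero_comp]
    exact ⟨A, 𝟙 A, inferInstance, K.liftCycles x j (c.next_eq' hij) hx', by simp⟩
  epi_g := by
    dsimp
    rw [epi_iff_surjective_up_to_refinements]
    intro A x
    obtain ⟨A', π, hπ, y, hy⟩ :=
      (exactAt_iff_exact_up_to_refinements K i j _ (c.prev_eq' hij) rfl).1 hj
        (x ≫ K.iCycles j) (by simp)
    exact ⟨A', π, hπ, y, by simpa [← cancel_mono (K.iCycles j)] using hy⟩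

/-- An exact complex with injective cycles is injective, provided that there is a differential
out of every degree. -/
lemma injective_of_injective_cycles (K : HomologicalComplex C c)
    (hc : ∀ i, c.Rel i (c.next i)) (hK : ∀ i, K.ExactAt i)
    (hZ : ∀ i, Injective (K.cycles i)) : Injective K where
  factors {A B} g f _ := by
    let σ (i : ι) := (K.shortExact_cycles (hc i) (hK _)).splittingOfInjective
    let r (i : ι) : K.X i ⟶ K.cycles i := (σ i).r
    let s (i : ι) : K.cycles (c.next i) ⟶ K.X i := (σ i).s
    have s_r (i : ι) : s i ≫ r i = 0 := (σ i).s_r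
    have s_p (i : ι) : s i ≫ K.toCycles i (c.next i) = 𝟙 _ := (σ i).s_g
    have id (i : ι) : r i ≫ K.iCycles i + K.toCycles i (c.next i) ≫ s i = 𝟙 _ := (σ i).id
    have i_r (i : ι) : K.iCycles i ≫ r i = 𝟙 _ := (σ i).f_r
    have s_d (i : ι) : s i ≫ K.d i (c.next i) = K.iCycles _ := by
      rw [← K.toCycles_i, reassoc_of% (s_p i)]
    have d_r (i : ι) : K.d i (c.next i) ≫ r _ = K.toCycles i (c.next i) := by
      rw [← K.toCycles_i, Category.assoc, i_r, Category.comp_id]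
    let v (i : ι) : B.X i ⟶ K.cycles i := Injective.factorThru (g.f i ≫ r i) (f.f i)
    have hv (i : ι) : f.f i ≫ v i = g.f i ≫ r i := Injective.comp_factorThru _ _
    refine ⟨{ f i := v i ≫ K.iCycles i + B.d i (c.next i) ≫ v _ ≫ s i
              comm' := ?_ }, ?_⟩
    · rintro i j hij
      obtain rfl := c.next_eq' hij
      simp [s_d]
    · ext i
      have hd : f.f i ≫ B.d i (c.next i) ≫ v _ ≫ s i =
          g.f i ≫ K.toCycles i (c.next i) ≫ s i := by
        rw [f.comm_assoc, reassoc_of% (hv (c.next i)), ← g.comm_assoc, ← d_r, Category.assoc]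
      rw [comp_f, Preadditive.comp_add, hd, reassoc_of% (hv i), ← Preadditive.comp_add, id,
        Category.comp_id]

end HomologicalComplex

/-- Theorem 6.5(ii) for chain complexes: a chain complex of left `R`-modules is an injective
object of `Ch(R)` if and only if it is exact and all the kernels of its differentials are
injective `R`-modules. -/
theorem statement19 {R : Type u} [Ring R] (X : ChainComplex (ModuleCat.{u} R) ℤ) :
    Injective X ↔
      ((∀ i : ℤ, IsZero (X.homology i)) ∧
        ∀ i : ℤ, Injective (kernel (X.d i (i - 1)))) := by
  have hnext (i : ℤ) : (ComplexShape.down ℤ).next i = i - 1 :=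
    (ComplexShape.down ℤ).next_eq' (by simp)
  have e (i : ℤ) : X.cycles i ≅ kernel (X.d i (i - 1)) :=
    (X.cyclesIsKernel i (i - 1) (hnext i)).conePointUniqueUpToIso (limit.isLimit _)
  simp only [← X.exactAt_iff_isZero_homology, ← fun i => Injective.iso_iff (e i)]
  constructor
  · intro _
    exact ⟨fun i => X.exactAt_of_injective (i := i + 1) (by simp) (by simp),
      X.injective_cycles⟩
  · rintro ⟨hX, hZ⟩
    exact X.injective_of_injective_cycles (fun i => by simp [hnext]) hX hZ
end
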